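/- arXiv:1901.09412 — 3 statements merged into one kernel-verified Lean document; each statement's English description precedes it below -/
import Mathlib

section
/- Let PW denote the paw graph (a triangle with one pendant edge attached). The graphs F on 6 vertices such that both F and its complement contain no copy of PW are exactly 2K_3 (two disjoint triangles) and K_{3,3}. -/
/-- The paw graph: a triangle `{0,1,2}` with a pendant edge `(2,3)`. -/
def paw : SimpleGraph (Fin 4) :=
  SimpleGraph.fromEdgeSet {s(0, 1), s(0, 2), s(1, 2), s(2, 3)}

/-- `G` contains a copy of `H` as a (not necessarily induced) subgraph. -/
def ContainsCopy {V W : Type*} (G : SimpleGraph V) (H : SimpleGraph W) : Prop :=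
  ∃ f : W → V, Function.Injective f ∧ ∀ a b : W, H.Adj a b → G.Adj (f a) (f b)

/-- Two disjoint triangles on 6 vertices. -/
def twoK3 : SimpleGraph (Fin 6) :=
  SimpleGraph.fromEdgeSet {s(0, 1), s(0, 2), s(1, 2), s(3, 4), s(3, 5), s(4, 5)}

/-- Elementary form of paw-freeness. -/
def PF {V : Type} (G : SimpleGraph V) : Prop :=
  ∀ a b c d : V, G.Adj a b → G.Adj a c → G.Adj b c → G.Adj c d → d = a ∨ d = b

theorem pf_iff {V : Type} (G : SimpleGraph V) : ¬ ContainsCopy G paw ↔ PF G := by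
  constructor
  · intro h a b c d hab hac hbc hcd
    by_contra hd
    push Not at hd
    apply h
    have h1 := hab.ne
    have h2 := hac.ne
    have h3 := hbc.ne
    have h4 := hcd.ne
    refine ⟨![a, b, c, d], ?_, ?_⟩
    · intro i j hij
      fin_cases i <;> fin_cases j <;> simp_all
    · intro i j hij
      have := hab.symm
      have := hac.symm
      have := hbc.symm
      have := hcd.symm
      fin_cases i <;> fin_cases j <;> simp_all [paw]
  · rintro h ⟨f, hf, hadj⟩
    have := h (f 0) (f 1) (f 2) (f 3) (hadj _ _ (by simp [paw])) (hadj _ _ (by simp [paw]))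
      (hadj _ _ (by simp [paw])) (hadj _ _ (by simp [paw]))
    rcases this with h | h
    · exact absurd (hf h) (by decide)
    · exact absurd (hf h) (by decide)

theorem pf_iso {V W : Type} {G : SimpleGraph V} {H : SimpleGraph W} (e : G ≃g H) (h : PF H) :
    PF G := by
  intro a b c d h1 h2 h3 h4
  have := h (e a) (e b) (e c) (e d) (e.map_adj_iff.2 h1) (e.map_adj_iff.2 h2)
    (e.map_adj_iff.2 h3) (e.map_adj_iff.2 h4)
  simpa using this

theorem iso_compl {V W : Type} {G : SimpleGraph V} {H : SimpleGraph W} (e : G ≃g H) :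
    Nonempty (Gᶜ ≃g Hᶜ) :=
  ⟨⟨e.toEquiv, by
    intro a b
    have : H.Adj (e a) (e b) ↔ G.Adj a b := e.map_adj_iff
    simp only [SimpleGraph.compl_adj]
    exact and_congr (not_congr e.toEquiv.injective.eq_iff) (not_congr this)⟩⟩

instance twoK3_dec : DecidableRel twoK3.Adj := by
  unfold twoK3
  infer_instance

theorem twoK3_pf : PF twoK3 := by
  unfold PF
  decide +kernel

theorem twoK3c_pf : PF twoK3ᶜ := by
  unfold PF
  decide +kernel

theorem k33_iso : Nonempty (completeBipartiteGraph (Fin 3) (Fin 3) ≃g twoK3ᶜ) :=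
  ⟨⟨finSumFinEquiv, by
    intro a b
    rcases a with a | a <;> rcases b with b | b <;> fin_cases a <;> fin_cases b <;>
      simp [twoK3] <;> decide⟩⟩

set_option maxHeartbeats 2000000 in
theorem from_triangle {V : Type} [Fintype V] [DecidableEq V] (G : SimpleGraph V)
    (h6 : Fintype.card V = 6) (h : PF G) (h' : PF Gᶜ) (a b c : V) (hab : G.Adj a b)
    (hac : G.Adj a c) (hbc : G.Adj b c) : Nonempty (G ≃g twoK3) := by
  have hcard : (({a, b, c} : Finset V)ᶜ).card = 3 := by
    rw [Finset.card_compl, h6, Finset.card_eq_three.2 ⟨a, b, c, hab.ne, hac.ne, hbc.ne, rfl⟩]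
  obtain ⟨x, y, z, hxy, hxz, hyz, hs⟩ := Finset.card_eq_three.1 hcard
  have hout : ∀ w, w ∈ ({x, y, z} : Finset V) → w ≠ a ∧ w ≠ b ∧ w ≠ c := by
    intro w hw
    rw [← hs] at hw
    simpa using hw
  obtain ⟨xa, xb, xc⟩ := hout x (by simp)
  obtain ⟨ya, yb, yc⟩ := hout y (by simp)
  obtain ⟨za, zb, zc⟩ := hout z (by simp)
  have no : ∀ w, w ≠ a → w ≠ b → w ≠ c → ¬ G.Adj a w ∧ ¬ G.Adj b w ∧ ¬ G.Adj c w := by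
    intro w wa wb wc
    refine ⟨fun hw => ?_, fun hw => ?_, fun hw => ?_⟩
    · have := h b c a w hbc hab.symm hac.symm hw
      tauto
    · have := h a c b w hac hab hbc.symm hw
      tauto
    · have := h a b c w hab hac hbc hw
      tauto
  obtain ⟨ax, bx, cx⟩ := no x xa xb xc
  obtain ⟨ay, bY, cy⟩ := no y ya yb yc
  obtain ⟨az, bz, cz⟩ := no z za zb zc
  have key : ∀ u v w : V, u ≠ v → u ≠ w → v ≠ w → u ≠ a → v ≠ a → w ≠ a →
      ¬ G.Adj a u → ¬ G.Adj a v → ¬ G.Adj a w → G.Adj u v := by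
    intro u v w huv huw hvw ua va wa au av aw
    by_contra hn
    have := h' u v a w ⟨huv, hn⟩ ⟨ua, fun t => au t.symm⟩ ⟨va, fun t => av t.symm⟩
      ⟨wa.symm, aw⟩
    rcases this with t | t
    · exact huw t.symm
    · exact hvw t.symm
  have exy := key x y z hxy hxz hyz xa ya za ax ay az
  have exz := key x z y hxz hxy hyz.symm xa za ya ax az ay
  have eyz := key y z x hyz hxy.symm hxz.symm ya za xa ay az ax
  have hinj : Function.Injective ![a, b, c, x, y, z] := by
    have n1 := hab.ne
    have n2 := hac.ne
    have n3 := hbc.ne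
    intro i j hij
    fin_cases i <;> fin_cases j <;> first | rfl | (exfalso; revert hij; simp [n1, n2, n3,
      n1.symm, n2.symm, n3.symm, hxy, hxz, hyz, hxy.symm, hxz.symm, hyz.symm, xa, xb, xc, ya, yb,
      yc, za, zb, zc, xa.symm, xb.symm, xc.symm, ya.symm, yb.symm, yc.symm, za.symm, zb.symm,
      zc.symm])
  have hbij := (Fintype.bijective_iff_injective_and_card ![a, b, c, x, y, z]).2
    ⟨hinj, by simp [h6]⟩
  refine ⟨RelIso.symm ⟨Equiv.ofBijective _ hbij, ?_⟩⟩
  intro i j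
  fin_cases i <;> fin_cases j <;>
    simp [twoK3, hab, hac, hbc, hab.symm, hac.symm, hbc.symm, exy, exz, eyz, exy.symm, exz.symm,
      eyz.symm, ax, bx, cx, ay, bY, cy, az, bz, cz, G.adj_comm x, G.adj_comm y, G.adj_comm z]

theorem ramsey33 {V : Type} [Fintype V] [DecidableEq V] (G : SimpleGraph V)
    (h6 : Fintype.card V = 6) :
    (∃ a b c, G.Adj a b ∧ G.Adj a c ∧ G.Adj b c) ∨
    (∃ a b c, Gᶜ.Adj a b ∧ Gᶜ.Adj a c ∧ Gᶜ.Adj b c) := by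
  classical
  obtain ⟨v⟩ : Nonempty V := Fintype.card_pos_iff.1 (by omega)
  have hsum : G.degree v + Gᶜ.degree v = 5 := by
    have := G.degree_compl v
    have := G.degree_lt_card_verts v
    omega
  have main : ∀ (H : SimpleGraph V) [DecidableRel H.Adj], 3 ≤ H.degree v →
      (∃ a b c, H.Adj a b ∧ H.Adj a c ∧ H.Adj b c) ∨
      (∃ a b c, Hᶜ.Adj a b ∧ Hᶜ.Adj a c ∧ Hᶜ.Adj b c) := by
    intro H _ hd
    rw [← H.card_neighborFinset_eq_degree] at hd
    obtain ⟨t, ht, htc⟩ := Finset.exists_subset_card_eq hd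
    obtain ⟨x, y, z, hxy, hxz, hyz, rfl⟩ := Finset.card_eq_three.1 htc
    have hx : H.Adj v x := by simpa using ht (show x ∈ _ by simp)
    have hy : H.Adj v y := by simpa using ht (show y ∈ _ by simp)
    have hz : H.Adj v z := by simpa using ht (show z ∈ _ by simp)
    by_cases e1 : H.Adj x y
    · exact Or.inl ⟨v, x, y, hx, hy, e1⟩
    by_cases e2 : H.Adj x z
    · exact Or.inl ⟨v, x, z, hx, hz, e2⟩
    by_cases e3 : H.Adj y z
    · exact Or.inl ⟨v, y, z, hy, hz, e3⟩
    exact Or.inr ⟨x, y, z, ⟨hxy, e1⟩, ⟨hxz, e2⟩, ⟨hyz, e3⟩⟩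
  by_cases hd : 3 ≤ G.degree v
  · exact main G hd
  · have := main Gᶜ (by omega)
    rw [compl_compl] at this
    exact this.symm

/-- The graphs `F` on 6 vertices such that both `F` and its complement are
paw-free are exactly `2K_3` and `K_{3,3}`. -/
theorem stmt_11 {V : Type} [Fintype V] [DecidableEq V] (F : SimpleGraph V)
    (h6 : Fintype.card V = 6) :
    (¬ ContainsCopy F paw ∧ ¬ ContainsCopy Fᶜ paw) ↔
    (Nonempty (F ≃g twoK3) ∨
     Nonempty (F ≃g completeBipartiteGraph (Fin 3) (Fin 3))) := by
  rw [pf_iff, pf_iff]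
  obtain ⟨k⟩ := k33_iso
  constructor
  · rintro ⟨h, h'⟩
    rcases ramsey33 F h6 with ⟨a, b, c, h1, h2, h3⟩ | ⟨a, b, c, h1, h2, h3⟩
    · exact Or.inl (from_triangle F h6 h h' a b c h1 h2 h3)
    · right
      obtain ⟨e⟩ := from_triangle Fᶜ h6 h' (by rwa [compl_compl]) a b c h1 h2 h3
      obtain ⟨e'⟩ := iso_compl e
      rw [compl_compl] at e'
      exact ⟨e'.trans k.symm⟩
  · rintro (⟨⟨e⟩⟩ | ⟨⟨e⟩⟩)
    · obtain ⟨e'⟩ := iso_compl e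
      exact ⟨pf_iso e twoK3_pf, pf_iso e' twoK3c_pf⟩
    · have e2 := e.trans k
      obtain ⟨e'⟩ := iso_compl e2
      rw [compl_compl] at e'
      exact ⟨pf_iso e2 twoK3c_pf, pf_iso e' twoK3_pf⟩
end

section
/- Let PW denote the paw graph. The graphs F on 5 vertices such that both F and the complement of F contain no copy of PW are exactly K_2 ∪ K_3, K_{2,3}, and C_5. -/
/-- The disjoint union of an edge `{0,1}` and a triangle `{2,3,4}`. -/
def k2UnionK3 : SimpleGraph (Fin 5) :=
  SimpleGraph.fromEdgeSet {s(0, 1), s(2, 3), s(2, 4), s(3, 4)}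

theorem paw_iff {V : Type} (G : SimpleGraph V) : ContainsCopy G paw ↔
    ∃ a b c d : V, G.Adj a b ∧ G.Adj a c ∧ G.Adj b c ∧ G.Adj c d ∧ a ≠ d ∧ b ≠ d := by
  constructor
  · rintro ⟨f, hf, h⟩
    refine ⟨f 0, f 1, f 2, f 3, h _ _ ?_, h _ _ ?_, h _ _ ?_, h _ _ ?_, hf.ne ?_, hf.ne ?_⟩ <;>
      simp [paw]
  · rintro ⟨a, b, c, d, hab, hac, hbc, hcd, had, hbd⟩
    have h1 := hab.ne
    have h2 := hac.ne
    have h3 := hbc.ne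
    have h4 := hcd.ne
    refine ⟨![a, b, c, d], ?_, ?_⟩
    · intro i j hij
      fin_cases i <;> fin_cases j <;> simp_all
    · intro i j hij
      fin_cases i <;> fin_cases j <;> simp_all [paw, SimpleGraph.adj_comm]

theorem paw_iso {V W : Type} {G : SimpleGraph V} {H : SimpleGraph W} (e : G ≃g H)
    (h : ContainsCopy G paw) : ContainsCopy H paw := by
  obtain ⟨f, hf, h⟩ := h
  exact ⟨e ∘ f, e.injective.comp hf, fun a b hab => e.map_adj_iff.2 (h a b hab)⟩

theorem paw_iso_both {V W : Type} {G : SimpleGraph V} {H : SimpleGraph W} (e : G ≃g H)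
    (h : ¬ ContainsCopy H paw ∧ ¬ ContainsCopy Hᶜ paw) :
    ¬ ContainsCopy G paw ∧ ¬ ContainsCopy Gᶜ paw := by
  refine ⟨fun k => h.1 (paw_iso e k), fun k => h.2 ?_⟩
  obtain ⟨f, hf, k⟩ := k
  refine ⟨e ∘ f, e.injective.comp hf, fun a b hab => ?_⟩
  have := k a b hab
  simp only [SimpleGraph.compl_adj, Function.comp, e.map_adj_iff, ne_eq,
    EmbeddingLike.apply_eq_iff_eq] at this ⊢
  exact this

/-- The symmetric relation on `Fin 5` given by ten bits. -/
def bitRel (p q r s t u v w x y : Bool) : Fin 5 → Fin 5 → Bool :=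
  ![![false, p, q, r, s], ![p, false, t, u, v], ![q, t, false, w, x],
    ![r, u, w, false, y], ![s, v, x, y, false]]

/-- A Boolean relation contains a paw. -/
def RelPaw (R : Fin 5 → Fin 5 → Bool) : Prop :=
  ∃ a b : Fin 5, a ≠ b ∧ R a b = true ∧ ∃ c : Fin 5, a ≠ c ∧ b ≠ c ∧ R a c = true ∧ R b c = true ∧
    ∃ d : Fin 5, a ≠ d ∧ b ≠ d ∧ c ≠ d ∧ R c d = true

/-- A Boolean relation is isomorphic to the one with the ten given bits. -/
def BitIso (R : Fin 5 → Fin 5 → Bool) (p q r s t u v w x y : Bool) : Prop :=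
  ∃ a b : Fin 5, a ≠ b ∧ R a b = p ∧ ∃ c : Fin 5, a ≠ c ∧ b ≠ c ∧ R a c = q ∧ R b c = t ∧
    ∃ d : Fin 5, a ≠ d ∧ b ≠ d ∧ c ≠ d ∧ R a d = r ∧ R b d = u ∧ R c d = w ∧
    ∃ e : Fin 5, a ≠ e ∧ b ≠ e ∧ c ≠ e ∧ d ≠ e ∧ R a e = s ∧ R b e = v ∧ R c e = x ∧ R d e = y

/-- Five labels, a copy of `Fin 5` on which case distinctions evaluate quickly. -/
inductive Lab : Type
  | l0 | l1 | l2 | l3 | l4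

/-- Choose one of five values by a label. -/
def Lab.pick {α : Type} (a b c d e : α) (l : Lab) : α :=
  match l with
  | l0 => a
  | l1 => b
  | l2 => c
  | l3 => d
  | l4 => e

/-- The index of a label. -/
def Lab.idx (l : Lab) : Fin 5 := Lab.pick 0 1 2 3 4 l

/-- Labels are different. -/
def Lab.dif (k l : Lab) : Bool :=
  Lab.pick (Lab.pick false true true true true l) (Lab.pick true false true true true l)
    (Lab.pick true true false true true l) (Lab.pick true true true false true l)
    (Lab.pick true true true true false l) k

theorem Lab.dif_ne (k l : Lab) (h : Lab.dif k l = true) : k.idx ≠ l.idx := by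
  cases k <;> cases l <;> revert h <;> decide

/-- Some label satisfies a Boolean predicate. -/
def Lab.some (f : Lab → Bool) : Bool := f l0 || (f l1 || (f l2 || (f l3 || f l4)))

theorem Lab.some_ex (f : Lab → Bool) (h : Lab.some f = true) : ∃ l, f l = true := by
  simp only [Lab.some, Bool.or_eq_true] at h
  rcases h with h | h | h | h | h <;> exact ⟨_, h⟩

/-- The relation of `bitRel`, on labels. -/
def labRel (p q r s t u v w x y : Bool) (k l : Lab) : Bool :=
  Lab.pick (Lab.pick false p q r s l) (Lab.pick p false t u v l) (Lab.pick q t false w x l)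
    (Lab.pick r u w false y l) (Lab.pick s v x y false l) k

theorem labRel_eq (p q r s t u v w x y : Bool) (k l : Lab) :
    labRel p q r s t u v w x y k l = bitRel p q r s t u v w x y k.idx l.idx := by
  cases k <;> cases l <;> rfl

/-- Boolean search for a paw. -/
def labPaw (R : Lab → Lab → Bool) : Bool :=
  Lab.some fun a => Lab.some fun b => Lab.dif a b && (R a b &&
    Lab.some fun c => Lab.dif a c && (Lab.dif b c && (R a c && (R b c &&
      Lab.some fun d => Lab.dif a d && (Lab.dif b d && (Lab.dif c d && R c d))))))

theorem labPaw_sound (R : Fin 5 → Fin 5 → Bool) (S : Lab → Lab → Bool)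
    (hS : ∀ k l, S k l = R k.idx l.idx) (h : labPaw S = true) : RelPaw R := by
  obtain ⟨a, h⟩ := Lab.some_ex _ h
  obtain ⟨b, h⟩ := Lab.some_ex _ h
  simp only [Bool.and_eq_true] at h
  obtain ⟨h1, h2, h⟩ := h
  obtain ⟨c, h⟩ := Lab.some_ex _ h
  simp only [Bool.and_eq_true] at h
  obtain ⟨h3, h4, h5, h6, h⟩ := h
  obtain ⟨d, h⟩ := Lab.some_ex _ h
  simp only [Bool.and_eq_true] at h
  obtain ⟨h7, h8, h9, h10⟩ := h
  rw [hS] at h2 h5 h6 h10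
  exact ⟨_, _, Lab.dif_ne _ _ h1, h2, _, Lab.dif_ne _ _ h3, Lab.dif_ne _ _ h4, h5, h6, _,
    Lab.dif_ne _ _ h7, Lab.dif_ne _ _ h8, Lab.dif_ne _ _ h9, h10⟩

theorem Lab.some_of (f : Lab → Bool) (l : Lab) (h : f l = true) : Lab.some f = true := by
  simp only [Lab.some, Bool.or_eq_true]
  cases l <;> simp [h]

theorem Lab.idx_surj (i : Fin 5) : ∃ l : Lab, l.idx = i := by
  fin_cases i
  · exact ⟨Lab.l0, rfl⟩
  · exact ⟨Lab.l1, rfl⟩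
  · exact ⟨Lab.l2, rfl⟩
  · exact ⟨Lab.l3, rfl⟩
  · exact ⟨Lab.l4, rfl⟩

theorem Lab.dif_of (k l : Lab) (h : k.idx ≠ l.idx) : Lab.dif k l = true := by
  cases k <;> cases l <;> first | rfl | exact absurd rfl h

theorem labPaw_complete (R : Fin 5 → Fin 5 → Bool) (S : Lab → Lab → Bool)
    (hS : ∀ k l, S k l = R k.idx l.idx) (h : labPaw S = false) : ¬ RelPaw R := by
  rintro ⟨a, b, h1, h2, c, h3, h4, h5, h6, d, h7, h8, h9, h10⟩
  obtain ⟨a, rfl⟩ := Lab.idx_surj a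
  obtain ⟨b, rfl⟩ := Lab.idx_surj b
  obtain ⟨c, rfl⟩ := Lab.idx_surj c
  obtain ⟨d, rfl⟩ := Lab.idx_surj d
  rw [← hS] at h2 h5 h6 h10
  refine absurd (Lab.some_of _ a (Lab.some_of _ b ?_)) (Bool.eq_false_iff.1 h)
  rw [Lab.dif_of _ _ h1, h2, Bool.true_and, Bool.true_and]
  refine Lab.some_of _ c ?_
  rw [Lab.dif_of _ _ h3, Lab.dif_of _ _ h4, h5, h6]
  simp only [Bool.true_and]
  refine Lab.some_of _ d ?_
  rw [Lab.dif_of _ _ h7, Lab.dif_of _ _ h8, Lab.dif_of _ _ h9, h10]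
  rfl

/-- Equality of bits. -/
def bitEq (p q : Bool) : Bool := cond p q (!q)

theorem bitEq_eq (p q : Bool) (h : bitEq p q = true) : p = q := by
  revert p q; decide

/-- Boolean search for an isomorphism. -/
def labIso (R : Lab → Lab → Bool) (p q r s t u v w x y : Bool) : Bool :=
  Lab.some fun a => Lab.some fun b => Lab.dif a b && (bitEq (R a b) p &&
    Lab.some fun c => Lab.dif a c && (Lab.dif b c && (bitEq (R a c) q && (bitEq (R b c) t &&
      Lab.some fun d => Lab.dif a d && (Lab.dif b d && (Lab.dif c d && (bitEq (R a d) r &&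
        (bitEq (R b d) u && (bitEq (R c d) w &&
          Lab.some fun e => Lab.dif a e && (Lab.dif b e && (Lab.dif c e && (Lab.dif d e &&
            (bitEq (R a e) s && (bitEq (R b e) v && (bitEq (R c e) x &&
              bitEq (R d e) y)))))))))))))))

theorem labIso_sound (R : Fin 5 → Fin 5 → Bool) (S : Lab → Lab → Bool)
    (hS : ∀ k l, S k l = R k.idx l.idx) (p q r s t u v w x y : Bool)
    (h : labIso S p q r s t u v w x y = true) : BitIso R p q r s t u v w x y := by
  obtain ⟨a, h⟩ := Lab.some_ex _ h
  obtain ⟨b, h⟩ := Lab.some_ex _ h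
  simp only [Bool.and_eq_true] at h
  obtain ⟨h1, h2, h⟩ := h
  obtain ⟨c, h⟩ := Lab.some_ex _ h
  simp only [Bool.and_eq_true] at h
  obtain ⟨h3, h4, h5, h6, h⟩ := h
  obtain ⟨d, h⟩ := Lab.some_ex _ h
  simp only [Bool.and_eq_true] at h
  obtain ⟨h7, h8, h9, h10, h11, h12, h⟩ := h
  obtain ⟨e, h⟩ := Lab.some_ex _ h
  simp only [Bool.and_eq_true] at h
  obtain ⟨h13, h14, h15, h16, h17, h18, h19, h20⟩ := h
  rw [hS] at h2 h5 h6 h10 h11 h12 h17 h18 h19 h20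
  exact ⟨_, _, Lab.dif_ne _ _ h1, bitEq_eq _ _ h2, _, Lab.dif_ne _ _ h3, Lab.dif_ne _ _ h4,
    bitEq_eq _ _ h5, bitEq_eq _ _ h6, _, Lab.dif_ne _ _ h7, Lab.dif_ne _ _ h8, Lab.dif_ne _ _ h9,
    bitEq_eq _ _ h10, bitEq_eq _ _ h11, bitEq_eq _ _ h12, _, Lab.dif_ne _ _ h13,
    Lab.dif_ne _ _ h14, Lab.dif_ne _ _ h15, Lab.dif_ne _ _ h16, bitEq_eq _ _ h17,
    bitEq_eq _ _ h18, bitEq_eq _ _ h19, bitEq_eq _ _ h20⟩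

/-- A Boolean predicate holds for both bits. -/
def bothBits (f : Bool → Bool) : Bool := f false && f true

theorem bothBits_all (f : Bool → Bool) (h : bothBits f = true) (b : Bool) : f b = true := by
  simp only [bothBits, Bool.and_eq_true] at h
  cases b
  · exact h.1
  · exact h.2

/-- The Boolean form of the classification of a single relation. -/
def labCheck (p q r s t u v w x y : Bool) : Bool :=
  labPaw (labRel p q r s t u v w x y) ||
  (labPaw (labRel (!p) (!q) (!r) (!s) (!t) (!u) (!v) (!w) (!x) (!y)) ||
  (labIso (labRel p q r s t u v w x y)
      true false false false false false false true true true ||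
  (labIso (labRel p q r s t u v w x y)
      false true true true true true true false false false ||
  labIso (labRel p q r s t u v w x y)
      true false false true true false false true false true)))

theorem labCheck_all : (bothBits fun p => bothBits fun q => bothBits fun r => bothBits fun s =>
    bothBits fun t => bothBits fun u => bothBits fun v => bothBits fun w => bothBits fun x =>
    bothBits fun y => labCheck p q r s t u v w x y) = true := by
  decide +kernel

theorem bit_main : ∀ p q r s t u v w x y : Bool,
    RelPaw (bitRel p q r s t u v w x y) ∨
    RelPaw (bitRel (!p) (!q) (!r) (!s) (!t) (!u) (!v) (!w) (!x) (!y)) ∨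
    BitIso (bitRel p q r s t u v w x y)
      true false false false false false false true true true ∨
    BitIso (bitRel p q r s t u v w x y)
      false true true true true true true false false false ∨
    BitIso (bitRel p q r s t u v w x y)
      true false false true true false false true false true := by
  intro p q r s t u v w x y
  have h := labCheck_all
  replace h := bothBits_all _ (bothBits_all _ (bothBits_all _ (bothBits_all _ (bothBits_all _ h p)
    q) r) s) t
  replace h := bothBits_all _ (bothBits_all _ (bothBits_all _ (bothBits_all _ (bothBits_all _ h u)
    v) w) x) y
  simp only [labCheck, Bool.or_eq_true] at h
  rcases h with h | h | h | h | h
  · exact Or.inl (labPaw_sound _ _ (labRel_eq _ _ _ _ _ _ _ _ _ _) h)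
  · exact Or.inr (Or.inl (labPaw_sound _ _ (labRel_eq _ _ _ _ _ _ _ _ _ _) h))
  · exact Or.inr (Or.inr (Or.inl
      (labIso_sound _ _ (labRel_eq _ _ _ _ _ _ _ _ _ _) _ _ _ _ _ _ _ _ _ _ h)))
  · exact Or.inr (Or.inr (Or.inr (Or.inl
      (labIso_sound _ _ (labRel_eq _ _ _ _ _ _ _ _ _ _) _ _ _ _ _ _ _ _ _ _ h))))
  · exact Or.inr (Or.inr (Or.inr (Or.inr
      (labIso_sound _ _ (labRel_eq _ _ _ _ _ _ _ _ _ _) _ _ _ _ _ _ _ _ _ _ h))))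

theorem iso_of {V W : Type} (F : SimpleGraph V)
    (H : SimpleGraph W) (φ : Fin 5 ≃ V) (w : Fin 5 ≃ W) (R : Fin 5 → Fin 5 → Bool)
    (hR : ∀ i j, F.Adj (φ i) (φ j) ↔ R i j = true)
    (p q r s t u v z x y : Bool)
    (hH : ∀ i j, H.Adj (w i) (w j) ↔ bitRel p q r s t u v z x y i j = true)
    (h : BitIso R p q r s t u v z x y) : Nonempty (F ≃g H) := by
  obtain ⟨a, b, ab, h1, c, ac, bc, h2, h3, d, ad, bd, cd, h4, h5, h6, e, ae, be, ce, de,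
    h7, h8, h9, h10⟩ := h
  have hinj : Function.Injective ![a, b, c, d, e] := by
    intro i j hij
    fin_cases i <;> fin_cases j <;> first | rfl | (exfalso; simp at hij; simp_all)
  let σ : Fin 5 ≃ Fin 5 := Equiv.ofBijective _ (Finite.injective_iff_bijective.1 hinj)
  have hsymm : ∀ i j, R i j = R j i := by
    intro i j
    rw [Bool.eq_iff_iff, ← hR, ← hR, F.adj_comm]
  have hirr : ∀ i, R i i = false := by
    intro i
    rw [Bool.eq_false_iff, Ne, ← hR]
    exact F.irrefl
  have key : ∀ i j, R (σ i) (σ j) = bitRel p q r s t u v z x y i j := by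
    intro i j
    change R (![a, b, c, d, e] i) (![a, b, c, d, e] j) = _
    fin_cases i <;> fin_cases j <;>
      first
        | exact hirr _
        | assumption
        | (rw [hsymm]; assumption)
  refine ⟨(SimpleGraph.Iso.symm ⟨(w.symm.trans σ).trans φ, ?_⟩)⟩
  intro i j
  obtain ⟨i, rfl⟩ := w.surjective i
  obtain ⟨j, rfl⟩ := w.surjective j
  simp [hR, hH, key]

theorem relPaw_of {V : Type} (F : SimpleGraph V) (φ : Fin 5 ≃ V) (R : Fin 5 → Fin 5 → Bool)
    (hR : ∀ i j, i ≠ j → R i j = true → F.Adj (φ i) (φ j))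
    (h : RelPaw R) : ContainsCopy F paw := by
  obtain ⟨a, b, ab, h1, c, ac, bc, h2, h3, d, ad, bd, cd, h4⟩ := h
  rw [paw_iff]
  exact ⟨φ a, φ b, φ c, φ d, hR _ _ ab h1, hR _ _ ac h2, hR _ _ bc h3, hR _ _ cd h4,
    φ.injective.ne ad, φ.injective.ne bd⟩

theorem k2k3_adj : ∀ i j, k2UnionK3.Adj i j ↔
    bitRel true false false false false false false true true true i j = true := by
  intro i j
  fin_cases i <;> fin_cases j <;> simp [k2UnionK3, bitRel]

theorem k23_adj : ∀ i j : Fin 5,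
    (completeBipartiteGraph (Fin 2) (Fin 3)).Adj ((finSumFinEquiv (m := 2) (n := 3)).symm i)
      ((finSumFinEquiv (m := 2) (n := 3)).symm j) ↔
    bitRel false true true true true true true false false false i j = true := by
  simp only [completeBipartiteGraph]
  decide +kernel

theorem c5_adj : ∀ i j, (SimpleGraph.cycleGraph 5).Adj i j ↔
    bitRel true false false true true false false true false true i j = true := by
  decide +kernel

theorem no_paw {W : Type} (H : SimpleGraph W) (w : Fin 5 ≃ W) (R : Fin 5 → Fin 5 → Bool)
    (hH : ∀ i j, H.Adj (w i) (w j) ↔ R i j = true)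
    (h1 : ¬ RelPaw R) (h2 : ¬ RelPaw (fun i j => !R i j)) :
    ¬ ContainsCopy H paw ∧ ¬ ContainsCopy Hᶜ paw := by
  constructor
  · intro k
    obtain ⟨a, b, c, d, k1, k2, k3, k4, k5, k6⟩ := (paw_iff _).1 k
    obtain ⟨a, rfl⟩ := w.surjective a
    obtain ⟨b, rfl⟩ := w.surjective b
    obtain ⟨c, rfl⟩ := w.surjective c
    obtain ⟨d, rfl⟩ := w.surjective d
    have e1 := k1.ne
    have e2 := k2.ne
    have e3 := k3.ne
    have e4 := k4.ne
    simp only [hH, ne_eq, EmbeddingLike.apply_eq_iff_eq] at *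
    exact h1 ⟨a, b, e1, k1, c, e2, e3, k2, k3, d, k5, k6, e4, k4⟩
  · intro k
    obtain ⟨a, b, c, d, k1, k2, k3, k4, k5, k6⟩ := (paw_iff _).1 k
    obtain ⟨a, rfl⟩ := w.surjective a
    obtain ⟨b, rfl⟩ := w.surjective b
    obtain ⟨c, rfl⟩ := w.surjective c
    obtain ⟨d, rfl⟩ := w.surjective d
    simp only [SimpleGraph.compl_adj, hH, ne_eq, EmbeddingLike.apply_eq_iff_eq] at *
    refine h2 ⟨a, b, k1.1, ?_, c, k2.1, k3.1, ?_, ?_, d, k5, k6, k4.1, ?_⟩ <;> simp_all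

theorem stmt_12 {V : Type} [Fintype V] [DecidableEq V] (F : SimpleGraph V)
    (h5 : Fintype.card V = 5) :
    (¬ ContainsCopy F paw ∧ ¬ ContainsCopy Fᶜ paw) ↔
    (Nonempty (F ≃g k2UnionK3) ∨
     Nonempty (F ≃g completeBipartiteGraph (Fin 2) (Fin 3)) ∨
     Nonempty (F ≃g SimpleGraph.cycleGraph 5)) := by
  classical
  constructor
  · rintro ⟨h1, h2⟩
    let φ : Fin 5 ≃ V := (Fintype.equivFinOfCardEq h5).symm
    let A : Fin 5 → Fin 5 → Bool := fun i j => decide (F.Adj (φ i) (φ j))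
    have hR : ∀ i j, F.Adj (φ i) (φ j) ↔ bitRel (A 0 1) (A 0 2) (A 0 3) (A 0 4) (A 1 2) (A 1 3)
        (A 1 4) (A 2 3) (A 2 4) (A 3 4) i j = true := by
      intro i j
      fin_cases i <;> fin_cases j <;> first | (simp [bitRel, A]; done) | (simp [bitRel, A]; exact F.adj_comm _ _)
    have hC : ∀ i j, i ≠ j → bitRel (!A 0 1) (!A 0 2) (!A 0 3) (!A 0 4) (!A 1 2) (!A 1 3)
        (!A 1 4) (!A 2 3) (!A 2 4) (!A 3 4) i j = true → Fᶜ.Adj (φ i) (φ j) := by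
      intro i j hij h
      rw [SimpleGraph.compl_adj, hR]
      refine ⟨φ.injective.ne hij, ?_⟩
      revert hij h
      generalize A 0 1 = a1, A 0 2 = a2, A 0 3 = a3, A 0 4 = a4, A 1 2 = a5, A 1 3 = a6,
        A 1 4 = a7, A 2 3 = a8, A 2 4 = a9, A 3 4 = a10
      fin_cases i <;> fin_cases j <;> simp [bitRel]
    rcases bit_main (A 0 1) (A 0 2) (A 0 3) (A 0 4) (A 1 2) (A 1 3)
        (A 1 4) (A 2 3) (A 2 4) (A 3 4) with h | h | h | h | h
    · exact absurd (relPaw_of F φ _ (fun i j _ => (hR i j).2) h) h1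
    · exact absurd (relPaw_of Fᶜ φ _ hC h) h2
    · exact Or.inl (iso_of F _ φ (Equiv.refl _) _ hR _ _ _ _ _ _ _ _ _ _ k2k3_adj h)
    · exact Or.inr (Or.inl (iso_of F _ φ (finSumFinEquiv (m := 2) (n := 3)).symm _ hR _ _ _ _ _ _ _ _ _ _
        k23_adj h))
    · exact Or.inr (Or.inr (iso_of F _ φ (Equiv.refl _) _ hR _ _ _ _ _ _ _ _ _ _ c5_adj h))
  · rintro (⟨⟨e⟩⟩ | ⟨⟨e⟩⟩ | ⟨⟨e⟩⟩)
    · exact paw_iso_both e (no_paw _ (Equiv.refl _) (bitRel true false false false false false false true true true)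
        k2k3_adj (labPaw_complete _ _ (labRel_eq _ _ _ _ _ _ _ _ _ _) (by decide +kernel))
        (labPaw_complete _ _ (fun k l => congrArg not (labRel_eq _ _ _ _ _ _ _ _ _ _ k l))
          (by decide +kernel)))
    · exact paw_iso_both e (no_paw _ (finSumFinEquiv (m := 2) (n := 3)).symm (bitRel false true true true true true true false false false)
        k23_adj (labPaw_complete _ _ (labRel_eq _ _ _ _ _ _ _ _ _ _) (by decide +kernel))
        (labPaw_complete _ _ (fun k l => congrArg not (labRel_eq _ _ _ _ _ _ _ _ _ _ k l))
          (by decide +kernel)))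
    · exact paw_iso_both e (no_paw _ (Equiv.refl _) (bitRel true false false true true false false true false true)
        c5_adj (labPaw_complete _ _ (labRel_eq _ _ _ _ _ _ _ _ _ _) (by decide +kernel))
        (labPaw_complete _ _ (fun k l => congrArg not (labRel_eq _ _ _ _ _ _ _ _ _ _ k l))
          (by decide +kernel)))
end

section
/- The graph F of order 21 obtained by substituting C_5, C_5, C_5, 2K_2, K_2 (in this cyclic order) into the 5-cycle v_1v_2v_3v_4v_5 has exactly five degree values, namely 8, 9, 10, 11, 12, and each degree value is constant on one substituted block; consequently neither F nor its complement contains a triangle or a claw all of whose vertices have pairwise distinct degrees in the respective host graph or all equal degrees. -/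
attribute [local instance] Classical.propDecidable

/-- The block of a vertex of the 21-vertex construction: blocks `0,1,2` have
5 vertices each (inducing `C_5`), block `3` has 4 vertices (inducing `2K_2`),
block `4` has 2 vertices (inducing `K_2`). -/
def block (v : Fin 21) : ℕ :=
  if v.val < 5 then 0 else if v.val < 10 then 1 else if v.val < 15 then 2
  else if v.val < 19 then 3 else 4

/-- Blocks `i` and `j` are consecutive on the 5-cycle `v_1 v_2 v_3 v_4 v_5`. -/
def blockAdj (i j : ℕ) : Prop := (i + 1) % 5 = j ∨ (j + 1) % 5 = i

/-- Adjacency inside a block: the `C_5` pattern in blocks `0,1,2`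
(positions `v % 5` around a 5-cycle), the `2K_2` pattern `{15,16},{17,18}` in
block `3`, and the single edge `{19,20}` in block `4`. -/
def innerAdj (u v : Fin 21) : Prop :=
  (u.val < 15 ∧
    ((u.val % 5 + 1) % 5 = v.val % 5 ∨ (v.val % 5 + 1) % 5 = u.val % 5)) ∨
  (15 ≤ u.val ∧ u.val < 19 ∧ (u.val - 15) / 2 = (v.val - 15) / 2) ∨
  19 ≤ u.val

/-- The graph of order 21 obtained by substituting `C_5, C_5, C_5, 2K_2, K_2`
(in this cyclic order) into the 5-cycle: blocks consecutive on the 5-cycle are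
completely joined, and each block induces its own graph. -/
def F16 : SimpleGraph (Fin 21) :=
  SimpleGraph.fromRel (fun u v =>
    (block u ≠ block v ∧ blockAdj (block u) (block v)) ∨
    (block u = block v ∧ innerAdj u v))

/-- The degree of the vertices of each block. -/
def blockDeg : ℕ → ℕ :=
  fun b => if b = 0 then 9 else if b = 1 then 12 else if b = 2 then 11
  else if b = 3 then 8 else 10

/-- `G` has no triangle whose three vertices have all equal or all pairwise
distinct degrees in `G`. -/
def NoSingularTriangle {V : Type*} [Fintype V] (G : SimpleGraph V) : Prop :=
  ¬ ∃ a b c : V, G.Adj a b ∧ G.Adj a c ∧ G.Adj b c ∧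
    ((G.degree a = G.degree b ∧ G.degree b = G.degree c) ∨
     (G.degree a ≠ G.degree b ∧ G.degree a ≠ G.degree c ∧
      G.degree b ≠ G.degree c))

/-- `G` has no claw (a vertex joined to three distinct vertices) whose four
vertices have all equal or all pairwise distinct degrees in `G`. -/
def NoSingularClaw {V : Type*} [Fintype V] (G : SimpleGraph V) : Prop :=
  ¬ ∃ v a b c : V, a ≠ b ∧ a ≠ c ∧ b ≠ c ∧
    G.Adj v a ∧ G.Adj v b ∧ G.Adj v c ∧
    ((G.degree v = G.degree a ∧ G.degree a = G.degree b ∧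
      G.degree b = G.degree c) ∨
     (G.degree v ≠ G.degree a ∧ G.degree v ≠ G.degree b ∧
      G.degree v ≠ G.degree c ∧ G.degree a ≠ G.degree b ∧
      G.degree a ≠ G.degree c ∧ G.degree b ≠ G.degree c))

section aux

/-- Decidable form of the adjacency relation. -/
def adjP (u v : Fin 21) : Prop :=
  u ≠ v ∧ (((block u ≠ block v ∧ ((block u + 1) % 5 = block v ∨ (block v + 1) % 5 = block u)) ∨
    (block u = block v ∧ innerAdj u v)) ∨
    ((block v ≠ block u ∧ ((block v + 1) % 5 = block u ∨ (block u + 1) % 5 = block v)) ∨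
    (block v = block u ∧ innerAdj v u)))

instance innerDec (u v : Fin 21) : Decidable (innerAdj u v) := by
  unfold innerAdj; infer_instance

instance adjDec (u v : Fin 21) : Decidable (adjP u v) := by
  unfold adjP; infer_instance

theorem adj_iff (u v : Fin 21) : F16.Adj u v ↔ adjP u v := Iff.rfl

theorem card_eq : ∀ v : Fin 21,
    (Finset.univ.filter fun w => adjP v w).card = blockDeg (block v) := by
  decide +kernel

theorem inner_card : ∀ v : Fin 21,
    (Finset.univ.filter fun w => adjP v w ∧ block v = block w).card ≤ 2 := by
  decide +kernel

theorem inner_card_compl : ∀ v : Fin 21,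
    (Finset.univ.filter fun w => (v ≠ w ∧ ¬ adjP v w) ∧ block v = block w).card ≤ 2 := by
  decide +kernel

theorem inner_tri : ∀ a b : Fin 21, (adjP a b ∧ block a = block b) →
    ∀ c, (adjP a c ∧ adjP b c) → block b ≠ block c := by
  decide +kernel

theorem inner_tri_compl : ∀ a b : Fin 21, ((a ≠ b ∧ ¬ adjP a b) ∧ block a = block b) →
    ∀ c, ((a ≠ c ∧ ¬ adjP a c) ∧ (b ≠ c ∧ ¬ adjP b c)) → block b ≠ block c := by
  decide +kernel

theorem outer : ∀ a b : Fin 21, adjP a b → block a ≠ block b →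
    ((block a + 1) % 5 = block b ∨ (block b + 1) % 5 = block a) := by
  decide +kernel

theorem outer_compl : ∀ a b : Fin 21, (a ≠ b ∧ ¬ adjP a b) → block a ≠ block b →
    ((block a + 2) % 5 = block b ∨ (block b + 2) % 5 = block a) := by
  decide +kernel

theorem block_lt : ∀ a : Fin 21, block a < 5 := by decide +kernel

theorem blockDeg_inj : ∀ a b : Fin 21,
    blockDeg (block a) = blockDeg (block b) ↔ block a = block b := by
  decide +kernel

theorem image_eq :
    (Finset.univ.image fun v : Fin 21 => blockDeg (block v)) = {8, 9, 10, 11, 12} := by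
  decide +kernel

theorem blockDeg_le : ∀ a : Fin 21, blockDeg (block a) ≤ 12 := by decide +kernel

/-- A vertex with at most two neighbours satisfying `p` has no three distinct ones. -/
theorem no_three (p : Fin 21 → Prop) [DecidablePred p]
    (h : (Finset.univ.filter p).card ≤ 2) (a b c : Fin 21)
    (hab : a ≠ b) (hac : a ≠ c) (hbc : b ≠ c) (ha : p a) (hb : p b) (hc : p c) : False := by
  have h3 : ({a, b, c} : Finset (Fin 21)).card = 3 := Finset.card_eq_three.2
    ⟨a, b, c, hab, hac, hbc, rfl⟩
  have hs : ({a, b, c} : Finset (Fin 21)) ⊆ Finset.univ.filter p := by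
    intro x hx
    simp only [Finset.mem_insert, Finset.mem_singleton] at hx
    rcases hx with rfl | rfl | rfl <;> simp [*]
  have := Finset.card_le_card hs
  omega

end aux

theorem deg_eq (v : Fin 21) : F16.degree v = blockDeg (block v) := by
  rw [← card_eq v, ← SimpleGraph.card_neighborFinset_eq_degree]
  congr 1
  ext w
  simp [adj_iff]

theorem compl_adj_iff (u v : Fin 21) : F16ᶜ.Adj u v ↔ (u ≠ v ∧ ¬ adjP u v) := by
  rw [SimpleGraph.compl_adj, adj_iff]

theorem deg_inj (a b : Fin 21) : F16.degree a = F16.degree b ↔ block a = block b := by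
  rw [deg_eq, deg_eq, blockDeg_inj]

theorem deg_compl_inj (a b : Fin 21) [Fintype (F16ᶜ.neighborSet a)]
    [Fintype (F16ᶜ.neighborSet b)] : F16ᶜ.degree a = F16ᶜ.degree b ↔ block a = block b := by
  have key : ∀ v, ∀ [Fintype (F16ᶜ.neighborSet v)], F16ᶜ.degree v = 20 - blockDeg (block v) := by
    intro v _
    have := SimpleGraph.degree_compl F16 v
    rw [deg_eq] at this
    simp only [Fintype.card_fin] at this
    convert this using 1
  rw [key, key, ← blockDeg_inj]
  have := blockDeg_le a
  have := blockDeg_le b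
  omega

/-- The substituted graph `F16` of order 21 has exactly the five degree values
`8, 9, 10, 11, 12`, each degree constant on its block (`9, 12, 11, 8, 10` on
the blocks substituted by `C_5, C_5, C_5, 2K_2, K_2` respectively);
consequently neither `F16` nor its complement contains a singular triangle or
a singular claw. -/
theorem stmt_16 :
    (∀ v : Fin 21, F16.degree v = blockDeg (block v)) ∧
    (Finset.univ.image fun v => F16.degree v) = {8, 9, 10, 11, 12} ∧
    NoSingularTriangle F16 ∧ NoSingularClaw F16 ∧
    NoSingularTriangle F16ᶜ ∧ NoSingularClaw F16ᶜ := by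
  refine ⟨deg_eq, ?_, ?_, ?_, ?_, ?_⟩
  · simp only [deg_eq]
    convert image_eq
  · rintro ⟨a, b, c, hab, hac, hbc, h⟩
    simp only [ne_eq, deg_inj] at h
    rw [adj_iff] at hab hac hbc
    rcases h with ⟨h1, h2⟩ | ⟨h1, h2, h3⟩
    · exact inner_tri a b ⟨hab, h1⟩ c ⟨hac, hbc⟩ h2
    · have := outer _ _ hab h1
      have := outer _ _ hac h2
      have := outer _ _ hbc h3
      have := block_lt a
      have := block_lt b
      have := block_lt c
      omega
  · rintro ⟨v, a, b, c, hab, hac, hbc, ha, hb, hc, h⟩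
    simp only [ne_eq, deg_inj] at h
    rw [adj_iff] at ha hb hc
    rcases h with ⟨h1, h2, h3⟩ | ⟨h1, h2, h3, h4, h5, h6⟩
    · exact no_three _ (inner_card v) a b c hab hac hbc ⟨ha, h1⟩ ⟨hb, h1.trans h2⟩
        ⟨hc, (h1.trans h2).trans h3⟩
    · have := outer _ _ ha h1
      have := outer _ _ hb h2
      have := outer _ _ hc h3
      have := block_lt v
      have := block_lt a
      have := block_lt b
      have := block_lt c
      omega
  · rintro ⟨a, b, c, hab, hac, hbc, h⟩
    simp only [ne_eq, deg_compl_inj] at h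
    rw [compl_adj_iff] at hab hac hbc
    rcases h with ⟨h1, h2⟩ | ⟨h1, h2, h3⟩
    · exact inner_tri_compl a b ⟨hab, h1⟩ c ⟨hac, hbc⟩ h2
    · have := outer_compl _ _ hab h1
      have := outer_compl _ _ hac h2
      have := outer_compl _ _ hbc h3
      have := block_lt a
      have := block_lt b
      have := block_lt c
      omega
  · rintro ⟨v, a, b, c, hab, hac, hbc, ha, hb, hc, h⟩
    simp only [ne_eq, deg_compl_inj] at h
    rw [compl_adj_iff] at ha hb hc
    rcases h with ⟨h1, h2, h3⟩ | ⟨h1, h2, h3, h4, h5, h6⟩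
    · exact no_three _ (inner_card_compl v) a b c hab hac hbc ⟨ha, h1⟩ ⟨hb, h1.trans h2⟩
        ⟨hc, (h1.trans h2).trans h3⟩
    · have := outer_compl _ _ ha h1
      have := outer_compl _ _ hb h2
      have := outer_compl _ _ hc h3
      have := block_lt v
      have := block_lt a
      have := block_lt b
      have := block_lt c
      omega
end
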